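/- Let n ≥ 2 and let p be a prime. Define ψ₀ : ℕ → [0,∞) by ψ₀(q) = p^{-1} if p divides q and ψ₀(q) = 0 otherwise. Then W_p(ψ₀, ℚ, n) = φ({x ∈ ℤ_p^n : |x|_p = 1 and min_{1≤i≤n} |x_i|_p ≤ p^{-1}}). -/

import Mathlib

open MeasureTheory

noncomputable section

/-- The p-adic projective distance (at vector level): the sup-norm of the wedge product
divided by the product of sup norms.  Invariant under scaling, it descends to
projective space. -/
def padicDelta (p : ℕ) [Fact p.Prime] {n : ℕ} (x y : Fin n → ℚ_[p]) : ℝ :=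
  (⨆ ij : Fin n × Fin n, ‖x ij.1 * y ij.2 - x ij.2 * y ij.1‖) / (‖x‖ * ‖y‖)

instance (p : ℕ) [Fact p.Prime] (n : ℕ) : MeasurableSpace (Fin n → ℚ_[p]) := borel _
instance (p : ℕ) [Fact p.Prime] (n : ℕ) : BorelSpace (Fin n → ℚ_[p]) := ⟨rfl⟩

/-- `ℤ_p^n` as a positive compact subset of `ℚ_p^n`. -/
def padicUnitPC (p : ℕ) [Fact p.Prime] (n : ℕ) :
    TopologicalSpace.PositiveCompacts (Fin n → ℚ_[p]) where
  carrier := {x | ∀ i, ‖x i‖ ≤ 1}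
  isCompact' := by
    have : {x : Fin n → ℚ_[p] | ∀ i, ‖x i‖ ≤ 1} = Set.univ.pi fun _ => Metric.closedBall 0 1 := by
      ext x; simp [Metric.mem_closedBall, dist_eq_norm]
    rw [this]
    exact isCompact_univ_pi fun i => isCompact_closedBall 0 1
  interior_nonempty' := by
    refine ⟨0, ?_⟩
    rw [mem_interior]
    refine ⟨Metric.ball 0 1, fun x hx i => ?_, Metric.isOpen_ball, by simp⟩
    have hx' : ‖x‖ < 1 := by simpa [dist_eq_norm] using hx
    exact le_of_lt (lt_of_le_of_lt (norm_le_pi_norm x i) hx')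

/-- Haar measure on `ℚ_p^n`, normalized so that `ℤ_p^n` has measure one. -/
def padicHaar (p : ℕ) [Fact p.Prime] (n : ℕ) : Measure (Fin n → ℚ_[p]) :=
  Measure.addHaarMeasure (padicUnitPC p n)

/-- The natural probability measure `μ_p` on `ℙ^{n-1}(ℚ_p)`:
`μ_p(M) = β(φ⁻¹(M) ∩ ℤ_p^n)`. -/
def muP (p : ℕ) [Fact p.Prime] (n : ℕ)
    (M : Set (Projectivization ℚ_[p] (Fin n → ℚ_[p]))) : ENNReal :=
  padicHaar p n {x | (∀ i, ‖x i‖ ≤ 1) ∧ ∃ hx : x ≠ 0, Projectivization.mk ℚ_[p] x hx ∈ M}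

/-- A visible (primitive) integer vector: the gcd of its coordinates is 1. -/
def IsPrim {n : ℕ} (v : Fin n → ℤ) : Prop := Finset.univ.gcd v = 1

/-- The sup-norm height of an integer vector. -/
def Hsup {n : ℕ} (v : Fin n → ℤ) : ℕ := Finset.univ.sup fun i => (v i).natAbs

/-- Embedding of an integer vector into `ℚ_p^n`. -/
def intPadic (p : ℕ) [Fact p.Prime] {n : ℕ} (v : Fin n → ℤ) : Fin n → ℚ_[p] :=
  fun i => ((v i : ℤ) : ℚ_[p])

/-- Embedding of an integer vector into `ℚ^n`. -/
def intRat {n : ℕ} (v : Fin n → ℤ) : Fin n → ℚ := fun i => ((v i : ℤ) : ℚ)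

/-- The set `W_p(ψ, ℚ, n)` of points of `ℙ^{n-1}(ℚ_p)` admitting infinitely many
rational approximations `y` with `δ_p(x,y) ≤ ψ(H(y))`. -/
def Wp (p : ℕ) [Fact p.Prime] (n : ℕ) (ψ : ℕ → ℝ) :
    Set (Projectivization ℚ_[p] (Fin n → ℚ_[p])) :=
  {x | {y : Projectivization ℚ (Fin n → ℚ) | ∃ v : Fin n → ℤ, IsPrim v ∧
      (∃ hv : intRat v ≠ 0, y = Projectivization.mk ℚ (intRat v) hv) ∧
      padicDelta p x.rep (intPadic p v) ≤ ψ (Hsup v)}.Infinite}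

/-- Closed ball for the projective metric, centered at the class of the vector `y`. -/
def Bdelta (p : ℕ) [Fact p.Prime] {n : ℕ} (y : Fin n → ℚ_[p]) (r : ℝ) :
    Set (Projectivization ℚ_[p] (Fin n → ℚ_[p])) :=
  {z | padicDelta p z.rep y ≤ r}

/-- The Euclidean norm of a vector in `ℝ^n`. -/
noncomputable def eNorm {n : ℕ} (x : Fin n → ℝ) : ℝ := Real.sqrt (∑ i, (x i) ^ 2)

/-- Norm of the wedge product of two vectors in `ℝ^n`:
`‖x ∧ y‖² = Σ_{i<j} (x_i y_j − x_j y_i)²`. -/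
noncomputable def wedgeNorm {n : ℕ} (x y : Fin n → ℝ) : ℝ :=
  Real.sqrt (∑ ij ∈ Finset.univ.filter (fun ij : Fin n × Fin n => ij.1 < ij.2),
    (x ij.1 * y ij.2 - x ij.2 * y ij.1) ^ 2)

/-- The projective distance at the infinite place (vector level):
`δ_∞(x,y) = ‖x ∧ y‖ / (‖x‖‖y‖)`. Invariant under scaling, it descends to `ℙ^{n-1}(ℝ)`. -/
noncomputable def deltaInf {n : ℕ} (x y : Fin n → ℝ) : ℝ :=
  wedgeNorm x y / (eNorm x * eNorm y)

/-- Embedding of an integer vector into `ℝ^n`. -/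
noncomputable def intReal {n : ℕ} (v : Fin n → ℤ) : Fin n → ℝ := fun i => ((v i : ℤ) : ℝ)

/-- The natural probability measure `μ_∞` on `ℙ^{n-1}(ℝ)`:
`μ_∞(M) = λ(φ⁻¹(M) ∩ B(0,1)) / λ(B(0,1))`. -/
noncomputable def muInf (n : ℕ) (M : Set (Projectivization ℝ (Fin n → ℝ))) : ENNReal :=
  MeasureTheory.volume {x : Fin n → ℝ | eNorm x ≤ 1 ∧
      ∃ hx : x ≠ 0, Projectivization.mk ℝ x hx ∈ M} /
    MeasureTheory.volume {x : Fin n → ℝ | eNorm x ≤ 1}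

/-- The set `W_∞(ψ, ℚ, n)` of points of `ℙ^{n-1}(ℝ)` admitting infinitely many
rational approximations `y` with `δ_∞(x,y) ≤ ψ(H(y))`. -/
noncomputable def Winf (n : ℕ) (ψ : ℕ → ℝ) : Set (Projectivization ℝ (Fin n → ℝ)) :=
  {x | {y : Projectivization ℚ (Fin n → ℚ) | ∃ v : Fin n → ℤ, IsPrim v ∧
      (∃ hv : intRat v ≠ 0, y = Projectivization.mk ℚ (intRat v) hv) ∧
      deltaInf x.rep (intReal v) ≤ ψ (Hsup v)}.Infinite}

/-- The Choi–Vaaler constant `c(n) = 2·π^{-1/2}·Γ(n/2+1)^{1/n}` for `k = ℚ`. -/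
noncomputable def cCV (n : ℕ) : ℝ :=
  2 * Real.pi ^ (-(1/2 : ℝ)) * Real.Gamma ((n : ℝ) / 2 + 1) ^ ((1 : ℝ) / n)

/-- The Euclidean height of a primitive integer vector. -/
noncomputable def He {n : ℕ} (v : Fin n → ℤ) : ℝ := eNorm (intReal v)

end

theorem padicDelta_smul_left (p : ℕ) [Fact p.Prime] {n : ℕ} {a : ℚ_[p]} (ha : a ≠ 0)
    (x y : Fin n → ℚ_[p]) : padicDelta p (a • x) y = padicDelta p x y := by
  have key : ∀ ij : Fin n × Fin n,
      ‖(a • x) ij.1 * y ij.2 - (a • x) ij.2 * y ij.1‖ =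
        ‖a‖ * ‖x ij.1 * y ij.2 - x ij.2 * y ij.1‖ := fun ij => by
    rw [← norm_mul]
    simp only [Pi.smul_apply, smul_eq_mul]
    congr 1
    ring
  simp only [padicDelta, key]
  rw [← Real.mul_iSup_of_nonneg (norm_nonneg a), norm_smul, mul_assoc,
    mul_div_mul_left _ _ (norm_ne_zero_iff.2 ha)]

theorem padicDelta_le_iff (p : ℕ) [Fact p.Prime] {n : ℕ} {x y : Fin n → ℚ_[p]}
    (hx : x ≠ 0) (hy : y ≠ 0) {c : ℝ} (hc : 0 ≤ c) :
    padicDelta p x y ≤ c ↔ ∀ i j, ‖x i * y j - x j * y i‖ ≤ c * (‖x‖ * ‖y‖) := by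
  rw [padicDelta, div_le_iff₀ (mul_pos (norm_pos_iff.2 hx) (norm_pos_iff.2 hy))]
  refine ⟨fun h i j => le_trans ?_ h, fun h => Real.iSup_le (fun ij => h _ _) (by positivity)⟩
  exact le_ciSup (f := fun ij : Fin n × Fin n => ‖x ij.1 * y ij.2 - x ij.2 * y ij.1‖)
    (Set.finite_range _).bddAbove (i, j)

theorem exists_norm_apply_eq_norm {p : ℕ} [Fact p.Prime] {n : ℕ} {x : Fin n → ℚ_[p]}
    (hx : x ≠ 0) : ∃ i, ‖x i‖ = ‖x‖ := by
  obtain ⟨k, -⟩ := Function.ne_iff.1 hx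
  obtain ⟨i, -, hi⟩ := Finset.exists_mem_eq_sup Finset.univ ⟨k, Finset.mem_univ k⟩ (fun i => ‖x i‖₊)
  exact ⟨i, by rw [Pi.norm_def, hi, coe_nnnorm]⟩

theorem IsPrim.exists_norm_eq_one {n : ℕ} {v : Fin n → ℤ} (hv : IsPrim v) (p : ℕ)
    [hp : Fact p.Prime] : ∃ i, ‖intPadic p v i‖ = 1 := by
  by_contra! h
  have hdvd : (p : ℤ) ∣ Finset.univ.gcd v := Finset.dvd_gcd fun i _ =>
    Padic.norm_intCast_lt_one_iff.1 (lt_of_le_of_ne (Padic.norm_int_le_one _) (h i))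
  rw [hv] at hdvd
  exact (Nat.prime_iff_prime_int.1 hp.out).not_dvd_one hdvd

theorem IsPrim.norm_intPadic {n : ℕ} {v : Fin n → ℤ} (hv : IsPrim v) (p : ℕ)
    [Fact p.Prime] : ‖intPadic p v‖ = 1 := by
  obtain ⟨i, hi⟩ := hv.exists_norm_eq_one p
  exact le_antisymm ((pi_norm_le_iff_of_nonneg zero_le_one).2 fun j => Padic.norm_int_le_one _)
    (hi ▸ norm_le_pi_norm _ i)

theorem IsPrim.intPadic_ne_zero {n : ℕ} {v : Fin n → ℤ} (hv : IsPrim v) (p : ℕ)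
    [Fact p.Prime] : intPadic p v ≠ 0 :=
  norm_ne_zero_iff.1 (by rw [hv.norm_intPadic p]; exact one_ne_zero)

theorem exists_natAbs_eq_Hsup {n : ℕ} (hn : 0 < n) (v : Fin n → ℤ) :
    ∃ i, (v i).natAbs = Hsup v := by
  obtain ⟨i, -, hi⟩ := Finset.exists_mem_eq_sup Finset.univ ⟨⟨0, hn⟩, Finset.mem_univ _⟩
    (fun i => (v i).natAbs)
  exact ⟨i, hi.symm⟩

theorem Padic.norm_le_inv_iff {p : ℕ} [Fact p.Prime] (x : ℚ_[p]) :
    ‖x‖ ≤ (p : ℝ)⁻¹ ↔ ‖x‖ < 1 := by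
  simpa using Padic.norm_le_pow_iff_norm_lt_pow_add_one x (-1)

/-- Integral vectors at distance zero from the same nonzero vector are rationally proportional. -/
theorem mk_intRat_eq_of_padicDelta_le_zero (p : ℕ) [Fact p.Prime] {n : ℕ} {x : Fin n → ℚ_[p]}
    (hx : x ≠ 0) {v w : Fin n → ℤ} (hv : IsPrim v) (hw : IsPrim w)
    (hv0 : intRat v ≠ 0) (hw0 : intRat w ≠ 0)
    (hxv : padicDelta p x (intPadic p v) ≤ 0) (hxw : padicDelta p x (intPadic p w) ≤ 0) :
    Projectivization.mk ℚ (intRat v) hv0 = Projectivization.mk ℚ (intRat w) hw0 := by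
  have cross : ∀ u : Fin n → ℤ, IsPrim u → padicDelta p x (intPadic p u) ≤ 0 →
      ∀ i j, x i * u j = x j * u i := fun u hu h i j => by
    have := (padicDelta_le_iff p hx (hu.intPadic_ne_zero p) le_rfl).1 h i j
    rw [zero_mul] at this
    exact sub_eq_zero.1 (norm_le_zero_iff.1 this)
  obtain ⟨k, hk⟩ := Function.ne_iff.1 hx
  rw [Pi.zero_apply] at hk
  have hwk : w k ≠ 0 := fun h0 => hw0 <| by
    ext j
    have := cross w hw hxw k j
    rw [h0, Int.cast_zero, mul_zero, mul_eq_zero] at this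
    simpa [intRat, hk] using this
  rw [Projectivization.mk_eq_mk_iff']
  refine ⟨(v k : ℚ) / w k, ?_⟩
  ext j
  have hj : v k * w j = v j * w k := by
    have : x k * x k * ((v k * w j : ℤ) : ℚ_[p]) = x k * x k * ((v j * w k : ℤ) : ℚ_[p]) := by
      push_cast
      linear_combination (x k * v k) * cross w hw hxw k j - (x k * w k) * cross v hv hxv k j
    exact_mod_cast mul_left_cancel₀ (mul_ne_zero hk hk) this
  have hwk' : (w k : ℚ) ≠ 0 := by exact_mod_cast hwk
  simp only [Pi.smul_apply, smul_eq_mul, intRat]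
  rw [div_mul_eq_mul_div, div_eq_iff hwk']
  exact_mod_cast hj

theorem exists_dvd_Hsup_of_mem_Wp (n p : ℕ) [Fact p.Prime]
    {z : Projectivization ℚ_[p] (Fin n → ℚ_[p])}
    (hz : z ∈ Wp p n (fun q => if p ∣ q then (p : ℝ)⁻¹ else 0)) :
    ∃ v : Fin n → ℤ, IsPrim v ∧ p ∣ Hsup v ∧ padicDelta p z.rep (intPadic p v) ≤ (p : ℝ)⁻¹ := by
  by_contra! h
  refine hz (Set.Subsingleton.finite ?_)
  rintro _ ⟨v, hv, ⟨hv0, rfl⟩, hxv⟩ _ ⟨w, hw, ⟨hw0, rfl⟩, hxw⟩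
  have le_zero : ∀ u : Fin n → ℤ, IsPrim u → padicDelta p z.rep (intPadic p u) ≤
      (if p ∣ Hsup u then (p : ℝ)⁻¹ else 0) → padicDelta p z.rep (intPadic p u) ≤ 0 :=
    fun u hu hxu => by
      split_ifs at hxu with hd
      · exact absurd hxu (h u hu hd).not_ge
      · exact hxu
  exact mk_intRat_eq_of_padicDelta_le_zero p z.rep_nonzero hv hw hv0 hw0
    (le_zero v hv hxv) (le_zero w hw hxw)

theorem norm_apply_le_of_padicDelta_le {n p : ℕ} [Fact p.Prime] {x : Fin n → ℚ_[p]}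
    (hx : ‖x‖ = 1) {v : Fin n → ℤ} (hv : IsPrim v)
    (hxv : padicDelta p x (intPadic p v) ≤ (p : ℝ)⁻¹) {i : Fin n} (hi : (p : ℤ) ∣ v i) :
    ‖x i‖ ≤ (p : ℝ)⁻¹ := by
  have hx0 : x ≠ 0 := norm_ne_zero_iff.1 (hx ▸ one_ne_zero)
  obtain ⟨j, hj⟩ := hv.exists_norm_eq_one p
  have h := (padicDelta_le_iff p hx0 (hv.intPadic_ne_zero p) (by positivity)).1 hxv i j
  rw [hx, hv.norm_intPadic p, mul_one, mul_one, Padic.norm_le_inv_iff] at h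
  have hvi : ‖intPadic p v i‖ < 1 := Padic.norm_intCast_lt_one_iff.2 hi
  have h2 : ‖x j * intPadic p v i‖ < 1 := by
    rw [norm_mul]
    exact mul_lt_one_of_nonneg_of_lt_one_right (hx ▸ norm_le_pi_norm x j) (norm_nonneg _) hvi
  rw [Padic.norm_le_inv_iff]
  calc ‖x i‖ = ‖x i * intPadic p v j - x j * intPadic p v i + x j * intPadic p v i‖ := by
        rw [sub_add_cancel, norm_mul, hj, mul_one]
    _ ≤ _ := Padic.nonarchimedean _ _
    _ < 1 := max_lt h h2

/-- The distance of unit vectors congruent modulo `p` is at most `p⁻¹`. -/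
theorem padicDelta_le_of_norm_sub_lt {n p : ℕ} [Fact p.Prime] {x y : Fin n → ℚ_[p]}
    (hx : ‖x‖ = 1) (hy : ‖y‖ = 1) (hxy : ∀ i, ‖x i - y i‖ < 1) :
    padicDelta p x y ≤ (p : ℝ)⁻¹ := by
  rw [padicDelta_le_iff p (norm_ne_zero_iff.1 (hx ▸ one_ne_zero))
    (norm_ne_zero_iff.1 (hy ▸ one_ne_zero)) (by positivity), hx, hy, mul_one, mul_one]
  intro i j
  rw [Padic.norm_le_inv_iff]
  have term : ∀ k l, ‖(x k - y k) * y l‖ < 1 := fun k l => by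
    rw [norm_mul]
    exact mul_lt_one_of_nonneg_of_lt_one_left (norm_nonneg _) (hxy k) (hy ▸ norm_le_pi_norm y l)
  calc ‖x i * y j - x j * y i‖ = ‖(x i - y i) * y j + -((x j - y j) * y i)‖ := by
        congr 1; ring
    _ ≤ _ := Padic.nonarchimedean _ _
    _ < 1 := max_lt (term i j) (by rw [norm_neg]; exact term j i)

theorem Padic.exists_nat_norm_sub_lt_one {p : ℕ} [Fact p.Prime] {x : ℚ_[p]} (hx : ‖x‖ ≤ 1) :
    ∃ m : ℕ, m < p ∧ ‖x - m‖ < 1 := by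
  obtain ⟨y, rfl⟩ : ∃ y : ℤ_[p], (y : ℚ_[p]) = x := ⟨⟨x, hx⟩, rfl⟩
  obtain ⟨m, hm, h⟩ := PadicInt.exists_mem_range y
  rw [IsLocalRing.mem_maximalIdeal, PadicInt.mem_nonunits, PadicInt.norm_def] at h
  exact ⟨m, hm, by rwa [PadicInt.coe_sub, PadicInt.coe_natCast] at h⟩

theorem mk_mem_Wp_of_norm_apply_le {n p : ℕ} [hp : Fact p.Prime] {x : Fin n → ℚ_[p]}
    (hx : ‖x‖ = 1) {i : Fin n} (hi : ‖x i‖ ≤ (p : ℝ)⁻¹) (hx0 : x ≠ 0) :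
    Projectivization.mk ℚ_[p] x hx0 ∈ Wp p n (fun q => if p ∣ q then (p : ℝ)⁻¹ else 0) := by
  obtain ⟨a, ha⟩ := Projectivization.exists_smul_eq_mk_rep ℚ_[p] x hx0
  have hdelta : ∀ y, padicDelta p (Projectivization.mk ℚ_[p] x hx0).rep y = padicDelta p x y :=
    fun y => by rw [← ha, Units.smul_def, padicDelta_smul_left p a.ne_zero]
  rw [Padic.norm_le_inv_iff] at hi
  choose m hmp hm using fun j => Padic.exists_nat_norm_sub_lt_one (hx ▸ norm_le_pi_norm x j)
  obtain ⟨k, hk⟩ := exists_norm_apply_eq_norm hx0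
  rw [hx] at hk
  have hki : k ≠ i := by rintro rfl; exact hi.ne hk
  have hmk : m k ≠ 0 := fun h0 => by
    have := hm k
    rw [h0, Nat.cast_zero, sub_zero] at this
    exact this.ne hk
  have hcop : Nat.Coprime p (m k) := Nat.coprime_of_lt_prime hmk (hmp k) hp.out
  let v : ℕ → Fin n → ℤ := fun N => Function.update (fun j => (m j : ℤ)) i ((p : ℤ) ^ (N + 1))
  have hvi : ∀ N, v N i = (p : ℤ) ^ (N + 1) := fun N => Function.update_self ..
  have hvj : ∀ N j, j ≠ i → v N j = m j := fun N j hj => Function.update_of_ne hj ..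
  have hprim : ∀ N, IsPrim (v N) := fun N => by
    have h1 : Finset.univ.gcd (v N) ∣ (p : ℤ) ^ (N + 1) :=
      hvi N ▸ Finset.gcd_dvd (Finset.mem_univ i)
    have h2 : Finset.univ.gcd (v N) ∣ (m k : ℤ) :=
      hvj N k hki ▸ Finset.gcd_dvd (Finset.mem_univ k)
    have hu : IsUnit (Finset.univ.gcd (v N)) :=
      ((Nat.isCoprime_iff_coprime.2 hcop).pow_left (m := N + 1)).isUnit_of_dvd' h1 h2
    rw [IsPrim, ← Finset.normalize_gcd]
    exact normalize_eq_one.2 hu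
  have hheight : ∀ N, Hsup (v N) = p ^ (N + 1) := fun N => by
    refine le_antisymm (Finset.sup_le fun j _ => ?_) ?_
    · by_cases hj : j = i
      · rw [hj, hvi, Int.natAbs_pow, Int.natAbs_natCast]
      · rw [hvj N j hj, Int.natAbs_natCast]
        exact (hmp j).le.trans (Nat.le_self_pow N.succ_ne_zero p)
    · have := Finset.le_sup (f := fun j => (v N j).natAbs) (Finset.mem_univ i)
      simpa only [Hsup, hvi, Int.natAbs_pow, Int.natAbs_natCast] using this
  have hv0 : ∀ N, intRat (v N) ≠ 0 := fun N h0 => by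
    have := congrFun h0 k
    simp [intRat, hvj N k hki, hmk] at this
  refine Set.infinite_of_injective_forall_mem
    (f := fun N => Projectivization.mk ℚ (intRat (v N)) (hv0 N)) ?_
    fun N => ⟨v N, hprim N, ⟨hv0 N, rfl⟩, ?_⟩
  · intro M N hMN
    obtain ⟨c, hc⟩ := (Projectivization.mk_eq_mk_iff' ..).1 hMN
    have hck := congrFun hc k
    have hci := congrFun hc i
    simp only [Pi.smul_apply, smul_eq_mul, intRat, hvi, hvj _ k hki] at hck hci
    have hc1 : c = 1 := mul_right_cancel₀ (by exact_mod_cast hmk) (hck.trans (one_mul _).symm)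
    rw [hc1, one_mul] at hci
    have : p ^ (N + 1) = p ^ (M + 1) := by exact_mod_cast hci
    have := Nat.pow_right_injective hp.out.two_le this
    omega
  · simp only [hdelta, hheight, if_pos (dvd_pow_self p N.succ_ne_zero)]
    refine padicDelta_le_of_norm_sub_lt hx ((hprim N).norm_intPadic p) fun j => ?_
    by_cases hj : j = i
    · subst hj
      have hpv : ‖-intPadic p (v N) j‖ < 1 := by
        rw [norm_neg]
        exact Padic.norm_intCast_lt_one_iff.2 (hvi N ▸ dvd_pow_self _ N.succ_ne_zero)
      rw [sub_eq_add_neg]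
      exact (Padic.nonarchimedean _ _).trans_lt (max_lt hi hpv)
    · simpa [intPadic, hvj N j hj] using hm j

/-- explicit description of `W_p(ψ₀)` for `ψ₀(q) = p⁻¹` if `p ∣ q`, else `0`. -/
theorem Wp_psi0_eq (n p : ℕ) (hn : 2 ≤ n) [Fact p.Prime] :
    Wp p n (fun q => if p ∣ q then (p : ℝ)⁻¹ else 0) =
      {z | ∃ x : Fin n → ℚ_[p], ‖x‖ = 1 ∧ (∃ i, ‖x i‖ ≤ (p : ℝ)⁻¹) ∧
        ∃ hx : x ≠ 0, z = Projectivization.mk ℚ_[p] x hx} := by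
  ext z
  constructor
  · intro hz
    obtain ⟨v, hv, hd, hle⟩ := exists_dvd_Hsup_of_mem_Wp n p hz
    obtain ⟨j, hj⟩ := exists_norm_apply_eq_norm z.rep_nonzero
    have hj0 : z.rep j ≠ 0 := norm_ne_zero_iff.1 (hj ▸ norm_ne_zero_iff.2 z.rep_nonzero)
    have hinv : (z.rep j)⁻¹ ≠ 0 := inv_ne_zero hj0
    have hnorm : ‖(z.rep j)⁻¹ • z.rep‖ = 1 := by
      rw [norm_smul, norm_inv, hj, inv_mul_cancel₀ (norm_ne_zero_iff.2 z.rep_nonzero)]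
    obtain ⟨i, hi⟩ := exists_natAbs_eq_Hsup (by omega) v
    have hx0 : (z.rep j)⁻¹ • z.rep ≠ 0 := smul_ne_zero hinv z.rep_nonzero
    refine ⟨(z.rep j)⁻¹ • z.rep, hnorm, ⟨i, ?_⟩, hx0, ?_⟩
    · refine norm_apply_le_of_padicDelta_le hnorm hv ?_ (Int.natCast_dvd.2 (hi ▸ hd))
      rwa [padicDelta_smul_left p hinv]
    · conv_lhs => rw [← z.mk_rep]
      exact (Projectivization.mk_eq_mk_iff' ..).2 ⟨z.rep j, by rw [smul_inv_smul₀ hj0]⟩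
  · rintro ⟨x, hx, ⟨i, hi⟩, hx0, rfl⟩
    exact mk_mem_Wp_of_norm_apply_le hx hi hx0
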